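/- Suppose x_3 = x_4 = ⋯ = x_n, ρ ≥ 0, and the hypotheses (i) x_1 ≤ x_2 ≤ min_{3≤i≤n} x_i, (ii) S + m·M_{12} ≥ −ρ, (iii) S + (m+1)·M_{12} < −(m+1)(m+n−1)·ρ hold. Then the quantity I := −((n−2)·( M_{12} + ((n−1)/2)·M_{33} )/(m+1))·[ S + (m+1)·M_{12} ] is nonnegative. -/

import Mathlib

open Finset

/-- `M x i j = x_i + x_j`. -/
noncomputable def solM (x : ℕ → ℝ) (i j : ℕ) : ℝ := x i + x j

/-- `S = Σ_{i<j, {i,j}≠{1,2}} M_{ij}`, indices running over `1,…,n`. -/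
noncomputable def solS (n : ℕ) (x : ℕ → ℝ) : ℝ :=
  ∑ i ∈ Icc 1 n, ∑ j ∈ Icc 1 n,
    if i < j ∧ ¬(i = 1 ∧ j = 2) then solM x i j else 0

/-- The function `f` from the algebra lemma. -/
noncomputable def solf (n m : ℕ) (x : ℕ → ℝ) : ℝ :=
  -(solS n x / ((m : ℝ) + 1)) * (solS n x + ((m : ℝ) + 1) * solM x 1 2)
    - solM x 1 2 * solS n x
    + ((∑ i ∈ Icc 1 n, ∑ j ∈ Icc 1 n,
        if i < j ∧ ¬(i = 1 ∧ j = 2) then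
          (solM x i j) ^ 2 +
            ∑ k ∈ (Icc 1 n).filter (fun k => k ≠ i ∧ k ≠ j), solM x i k * solM x j k
        else 0)
      + ((m : ℝ) + 1) *
          ∑ k ∈ (Icc 1 n).filter (fun k => k ≠ 1 ∧ k ≠ 2), solM x 1 k * solM x 2 k)

/-- Passing from `n` to `n + 1` adds to `solS` the pairs `(i, n + 1)` with `i ≤ n`. -/
lemma solS_succ (n : ℕ) (hn : 2 ≤ n) (x : ℕ → ℝ) :
    solS (n + 1) x = solS n x + ((∑ i ∈ Icc 1 n, x i) + n * x (n + 1)) := by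
  have hlast : ∑ j ∈ Icc 1 (n + 1),
      (if n + 1 < j ∧ ¬(n + 1 = 1 ∧ j = 2) then solM x (n + 1) j else 0) = 0 := by
    refine sum_eq_zero fun j hj => if_neg ?_
    have := (mem_Icc.mp hj).2
    omega
  have hnew : ∀ i ∈ Icc 1 n,
      (if i < n + 1 ∧ ¬(i = 1 ∧ n + 1 = 2) then solM x i (n + 1) else 0) = x i + x (n + 1) := by
    intro i hi
    have := (mem_Icc.mp hi).2
    exact if_pos (by omega)
  unfold solS
  rw [sum_Icc_succ_top (by omega), hlast, add_zero]
  simp_rw [sum_Icc_succ_top (show 1 ≤ n + 1 by omega)]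
  rw [sum_add_distrib, sum_congr rfl hnew, sum_add_distrib]
  simp

/-- Each `x i` occurs in `n - 1` pairs, so `solS` is `(n - 1) Σ x i - M₁₂`. -/
lemma solS_eq (n : ℕ) (hn : 2 ≤ n) (x : ℕ → ℝ) :
    solS n x = ((n : ℝ) - 1) * (∑ i ∈ Icc 1 n, x i) - solM x 1 2 := by
  induction n, hn using Nat.le_induction with
  | base => norm_num [solS, solM, sum_Icc_succ_top]
  | succ n hn ih =>
    rw [solS_succ n hn, ih, sum_Icc_succ_top (by omega)]
    push_cast
    ring

/-- The sum of the `x i` when they agree from index `3` on. -/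
lemma sum_Icc_eq_of_tail_const (n : ℕ) (hn : 2 ≤ n) (x : ℕ → ℝ)
    (hx : ∀ i, 3 ≤ i → i ≤ n → x i = x 3) :
    ∑ i ∈ Icc 1 n, x i = x 1 + x 2 + ((n : ℝ) - 2) * x 3 := by
  induction n, hn using Nat.le_induction with
  | base => norm_num [sum_Icc_succ_top]
  | succ n hn ih =>
    rw [sum_Icc_succ_top (by omega), ih fun i h h' => hx i h (by omega),
      hx (n + 1) (by omega) le_rfl]
    push_cast
    ring

/-- The term `I` is nonnegative. -/
theorem term_I_nonneg (n m : ℕ) (hn : 4 ≤ n) (hm : 1 ≤ m) (ρ : ℝ) (hρ : 0 ≤ ρ)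
    (x : ℕ → ℝ)
    (hx : ∀ i, 3 ≤ i → i ≤ n → x i = x 3)
    (h1 : x 1 ≤ x 2 ∧ ∀ i, 3 ≤ i → i ≤ n → x 2 ≤ x i)
    (h2 : solS n x + (m : ℝ) * solM x 1 2 ≥ -ρ)
    (h3 : solS n x + ((m : ℝ) + 1) * solM x 1 2 <
      -(((m : ℝ) + 1) * ((m : ℝ) + (n : ℝ) - 1)) * ρ) :
    0 ≤ -(((n : ℝ) - 2) * (solM x 1 2 + ((n : ℝ) - 1) / 2 * solM x 3 3) / ((m : ℝ) + 1)) *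
        (solS n x + ((m : ℝ) + 1) * solM x 1 2) := by
  have hS : solS n x =
      ((n : ℝ) - 2) * (solM x 1 2 + ((n : ℝ) - 1) / 2 * solM x 3 3) := by
    rw [solS_eq n (by omega), sum_Icc_eq_of_tail_const n (by omega) x hx]
    simp only [solM]
    ring
  rw [← hS]
  have hm' : (1 : ℝ) ≤ m := by exact_mod_cast hm
  have hn' : (4 : ℝ) ≤ n := by exact_mod_cast hn
  have hcoef : 0 ≤ (m : ℝ) * (m + n - 1) - 1 := by nlinarith
  have hSnonneg : 0 ≤ solS n x := by
    have hρ' : 0 ≤ ((m : ℝ) + 1) * ((m * (m + n - 1) - 1) * ρ) := by positivity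
    nlinarith
  have hneg : solS n x + ((m : ℝ) + 1) * solM x 1 2 ≤ 0 := by
    have : 0 ≤ ((m : ℝ) + 1) * (m + n - 1) * ρ :=
      mul_nonneg (mul_nonneg (by linarith) (by linarith)) hρ
    linarith
  exact mul_nonneg_of_nonpos_of_nonpos
    (neg_nonpos.mpr (div_nonneg hSnonneg (by linarith))) hneg
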